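/- SafeTab-P satisfies unbounded zCDP: Let I be a domain of records. For each level i = 1, ..., ω, let g_i : I → 2^{P_i} assign records to groups with stability Δ(g_i) ≤ s_i, let ρ_i > 0, and suppose each group j ∈ P_i is designated either TotalOnly or adaptive. The SafeTab-P mechanism, on input database x, for each level i and each group j ∈ P_i with sub-multiset x_{i,j} of records r of x with j ∈ g_i(r), outputs: if j is TotalOnly, |x_{i,j}| + N_Z(s_i/(2ρ_i)) noise; otherwise, the two-stage adaptive tabulation mechanism with total budget ρ_i/s_i and split γ applied to x_{i,j} (first a noisy total count with noise N_Z(s_i/(2γρ_i)), then, based on thresholds, a vector of cell counts of a chosen partition each perturbed by independent N_Z(s_i/(2(1−γ)ρ_i)) noise). All noise samples are independent. Then SafeTab-P satisfies ρ_total-zCDP with ρ_total = Σ_{i=1}^{ω} ρ_i. -/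

import Mathlib

open scoped BigOperators ENNReal

/-- Rényi divergence of order `α` between two discrete distributions. -/
noncomputable def renyiDiv {β : Type*} (α : ℝ) (P Q : PMF β) : ℝ :=
  (α - 1)⁻¹ * Real.log (∑' b : β, (P b).toReal ^ α * (Q b).toReal ^ (1 - α))

/-- Two databases (multisets of records) are neighbors if their symmetric
difference contains exactly one record. -/
def Neighbor {I : Type*} [DecidableEq I] (x x' : Multiset I) : Prop :=
  ((x - x') + (x' - x)).card = 1

/-- A randomized mechanism `M` satisfies `ρ`-zCDP. -/
def zCDP {I β : Type*} [DecidableEq I] (M : Multiset I → PMF β) (ρ : ℝ) : Prop :=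
  ∀ x x' : Multiset I, Neighbor x x' → ∀ α : ℝ, 1 < α →
    renyiDiv α (M x) (M x') ≤ α * ρ

universe u

/-- Product of finitely many independent distributions, indexed by `Fin n`. -/
noncomputable def pmfPiFin : (n : ℕ) → (β : Fin n → Type u) →
    ((i : Fin n) → PMF (β i)) → PMF ((i : Fin n) → β i)
  | 0, _, _ => PMF.pure (fun i => i.elim0)
  | n + 1, β, p =>
      (p 0).bind fun b0 =>
        (pmfPiFin n (fun i => β i.succ) (fun i => p i.succ)).bind fun f =>
          PMF.pure (Fin.cons b0 f)

/-- Product of independent distributions indexed by a finite type. -/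
noncomputable def pmfPi {ι : Type*} [Fintype ι] {β : ι → Type*}
    (p : (i : ι) → PMF (β i)) : PMF ((i : ι) → β i) :=
  (pmfPiFin (Fintype.card ι) (fun k => β ((Fintype.equivFin ι).symm k))
      (fun k => p ((Fintype.equivFin ι).symm k))).map
    ⇑(Equiv.piCongrLeft' β (Fintype.equivFin ι)).symm

open scoped ENNReal

/-- The (real-valued) unnormalized discrete Gaussian mass function. -/
noncomputable def dgaussMass (σ2 : ℝ) (y : ℤ) : ℝ :=
  Real.exp (-(y : ℝ) ^ 2 / (2 * σ2))

lemma dgaussMass_summable {σ2 : ℝ} (h : 0 < σ2) : Summable (dgaussMass σ2) := by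
  have h2 : (0 : ℝ) < 2 * σ2 := by linarith
  have hgeo : Summable fun n : ℕ => Real.exp ((n : ℝ) * (-(2 * σ2)⁻¹)) :=
    Real.summable_exp_nat_mul_iff.mpr (by rw [neg_lt_zero]; positivity)
  have hnat : Summable fun n : ℕ => dgaussMass σ2 (n : ℤ) := by
    apply Summable.of_nonneg_of_le (fun n => (Real.exp_pos _).le) ?_ hgeo
    intro n
    apply Real.exp_le_exp.mpr
    have hn : (n : ℝ) ≤ (n : ℝ) ^ 2 := by exact_mod_cast Nat.le_self_pow two_ne_zero n
    push_cast [dgaussMass]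
    rw [show (n : ℝ) * (-(2 * σ2)⁻¹) = -((n : ℝ) / (2 * σ2)) by ring,
      show -(n : ℝ) ^ 2 / (2 * σ2) = -((n : ℝ) ^ 2 / (2 * σ2)) by ring]
    apply neg_le_neg
    gcongr
  apply Summable.of_nat_of_neg hnat
  have : ∀ n : ℕ, dgaussMass σ2 (-(n : ℤ)) = dgaussMass σ2 (n : ℤ) := by
    intro n; simp [dgaussMass]
  simpa only [this] using hnat

lemma dgaussMass_pos (σ2 : ℝ) (y : ℤ) : 0 < dgaussMass σ2 y := Real.exp_pos _

lemma dgaussMass_tsum_pos {σ2 : ℝ} (h : 0 < σ2) : 0 < ∑' y : ℤ, dgaussMass σ2 y :=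
  Summable.tsum_pos (dgaussMass_summable h) (fun y => (dgaussMass_pos σ2 y).le) 0 (dgaussMass_pos σ2 0)

/-- The discrete Gaussian distribution `N_ℤ(σ²)` centered at `0`, as a `PMF` on `ℤ`
(defined to be a point mass when `σ² ≤ 0`). -/
noncomputable def dgaussPMF (σ2 : ℝ) : PMF ℤ :=
  if h : 0 < σ2 then
    ⟨fun x => ENNReal.ofReal (dgaussMass σ2 x / ∑' y : ℤ, dgaussMass σ2 y), by
      have hS : (0 : ℝ) < ∑' y : ℤ, dgaussMass σ2 y := dgaussMass_tsum_pos h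
      have key : ∑' x : ℤ, ENNReal.ofReal (dgaussMass σ2 x / ∑' y : ℤ, dgaussMass σ2 y) = 1 := by
        rw [← ENNReal.ofReal_tsum_of_nonneg (fun x => div_nonneg (dgaussMass_pos σ2 x).le hS.le)
          ((dgaussMass_summable h).div_const _), tsum_div_const, div_self hS.ne',
          ENNReal.ofReal_one]
      exact key ▸ ENNReal.summable.hasSum⟩
  else PMF.pure 0

/-- The two-stage adaptive tabulation mechanism with budget `ρ` and split `γ`:
first release a noisy total count `y0` of the database using discrete Gaussian noise of
variance `1/(2γρ)`; then, depending on which of the thresholds `Θ1 ≤ Θ2 ≤ Θ3` the noisy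
count exceeds, select one of four fixed partitions of the record domain (partition `t`
has `n t` cells, given by `part t : I → Fin (n t)`) and release all of its cell counts,
each perturbed by independent discrete Gaussian noise of variance `1/(2(1-γ)ρ)`. -/
noncomputable def twoStage {I : Type*} (n : Fin 4 → ℕ) (part : (t : Fin 4) → I → Fin (n t))
    (Θ1 Θ2 Θ3 : ℤ) (ρ γ : ℝ) (x : Multiset I) :
    PMF (ℤ × Σ t : Fin 4, (Fin (n t) → ℤ)) :=
  (dgaussPMF (1 / (2 * γ * ρ))).bind fun z0 =>
    let y0 : ℤ := (Multiset.card x : ℤ) + z0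
    let t : Fin 4 := if y0 < Θ1 then 0 else if y0 < Θ2 then 1 else if y0 < Θ3 then 2 else 3
    (pmfPi fun _ : Fin (n t) => dgaussPMF (1 / (2 * (1 - γ) * ρ))).bind fun noise =>
      PMF.pure (y0, ⟨t, fun c => ((x.filter fun r => part t r = c).card : ℤ) + noise c⟩)

/-- The SafeTab-P mechanism. For each population-group level `i` and each group `j : P i`,
let `x_{i,j}` be the sub-multiset of records `r` of `x` with `j ∈ g i r`. If `j` is a
TotalOnly group, release the count of `x_{i,j}` perturbed by discrete Gaussian noise of
variance `s i / (2 ρ i)`; otherwise apply the two-stage adaptive tabulation mechanism with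
total budget `ρ i / s i` and split `γ` to `x_{i,j}`. All noise is independent. -/
noncomputable def safeTabP {I : Type*} [DecidableEq I] {ω : ℕ}
    (P : Fin ω → Type*) [∀ i, Fintype (P i)] [∀ i, DecidableEq (P i)]
    (g : (i : Fin ω) → I → Finset (P i)) (s : Fin ω → ℕ) (ρ : Fin ω → ℝ) (γ : ℝ)
    (TotalOnly : (i : Fin ω) → P i → Prop) [∀ i, DecidablePred (TotalOnly i)]
    (nCells : (i : Fin ω) → P i → Fin 4 → ℕ)
    (part : (i : Fin ω) → (j : P i) → (t : Fin 4) → I → Fin (nCells i j t))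
    (Θ1 Θ2 Θ3 : (i : Fin ω) → P i → ℤ) (x : Multiset I) :
    PMF ((i : Fin ω) → (j : P i) → (ℤ ⊕ (ℤ × Σ t : Fin 4, (Fin (nCells i j t) → ℤ)))) :=
  pmfPi fun i => pmfPi fun j =>
    let xij := x.filter fun r => j ∈ g i r
    if TotalOnly i j then
      (dgaussPMF ((s i : ℝ) / (2 * ρ i))).map
        (fun zn => Sum.inl ((Multiset.card xij : ℤ) + zn))
    else
      (twoStage (nCells i j) (part i j) (Θ1 i j) (Θ2 i j) (Θ3 i j)
        (ρ i / (s i : ℝ)) γ xij).map Sum.inr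


lemma shifted_summable {σ2 : ℝ} (h : 0 < σ2) (m : ℝ) :
    Summable fun y : ℤ => Real.exp (-((y : ℝ) - m) ^ 2 / (2 * σ2)) := by
  have h2 : 0 < 2 * σ2 := by linarith
  apply Summable.of_nonneg_of_le (fun n => (Real.exp_pos _).le) ?_
    ((dgaussMass_summable h2).mul_left (Real.exp (m ^ 2 / (2 * σ2))))
  intro y
  rw [dgaussMass, ← Real.exp_add]
  apply Real.exp_le_exp.mpr
  have : m ^ 2 / (2 * σ2) + -(y : ℝ) ^ 2 / (2 * (2 * σ2)) - -((y : ℝ) - m) ^ 2 / (2 * σ2)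
      = ((y : ℝ) - 2 * m) ^ 2 / (2 * (2 * σ2)) := by
    field_simp
    ring
  have h3 : 0 ≤ ((y : ℝ) - 2 * m) ^ 2 / (2 * (2 * σ2)) := by positivity
  linarith

lemma shifted_tsum_le {σ2 : ℝ} (h : 0 < σ2) (m : ℝ) :
    ∑' y : ℤ, Real.exp (-((y : ℝ) - m) ^ 2 / (2 * σ2)) ≤ ∑' y : ℤ, dgaussMass σ2 y := by
  have hpi := Real.pi_pos
  obtain ⟨a, ha⟩ : ∃ a : ℝ, a = 1 / (2 * Real.pi * σ2) := ⟨_, rfl⟩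
  have ha0 : 0 < a := by rw [ha]; positivity
  have hσ : σ2 = 1 / (2 * Real.pi * a) := by rw [ha]; field_simp
  have key : ((∑' y : ℤ, Real.exp (-((y : ℝ) - m) ^ 2 / (2 * σ2)) : ℝ) : ℂ)
      = Complex.exp (-Real.pi * a * m ^ 2) * (1 / (a : ℂ) ^ (1 / 2 : ℂ) *
        ∑' n : ℤ, Complex.exp (-Real.pi / a * (n + Complex.I * (a * m : ℂ)) ^ 2)) := by
    rw [← Complex.tsum_exp_neg_quadratic (by simpa using ha0), ← tsum_mul_left, Complex.ofReal_tsum]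
    congr 1
    ext n
    rw [← Complex.exp_add, Complex.ofReal_exp]
    congr 1
    rw [hσ]
    push_cast
    have : (Real.pi : ℂ) ≠ 0 := by exact_mod_cast hpi.ne'
    have : (a : ℂ) ≠ 0 := by exact_mod_cast ha0.ne'
    field_simp
    ring
  have hn : ∀ n : ℤ, ‖Complex.exp (-Real.pi / a * (n + Complex.I * (a * m : ℂ)) ^ 2)‖
      = Real.exp (Real.pi * a * m ^ 2) * Real.exp (-Real.pi / a * (n : ℝ) ^ 2) := by
    intro n
    rw [Complex.norm_exp, ← Real.exp_add]
    congr 1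
    have : (-Real.pi / a * (n + Complex.I * (a * m : ℂ)) ^ 2 : ℂ)
      = ((Real.pi * a * m ^ 2 + -Real.pi / a * (n : ℝ) ^ 2 : ℝ) : ℂ)
        + ((-2 * Real.pi * n * m : ℝ) : ℂ) * Complex.I := by
      push_cast
      have : (a : ℂ) ≠ 0 := by exact_mod_cast ha0.ne'
      field_simp
      ring_nf
      rw [Complex.I_sq]
      ring
    rw [this]
    simp only [Complex.add_re, Complex.ofReal_re, Complex.re_ofReal_mul, Complex.I_re]
    ring
  have hs : Summable fun n : ℤ => Real.exp (-Real.pi / a * (n : ℝ) ^ 2) := by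
    have := dgaussMass_summable (σ2 := a / (2 * Real.pi)) (by positivity)
    refine this.congr fun n => ?_
    rw [dgaussMass]
    congr 1
    field_simp
  have h0 : 0 ≤ ∑' y : ℤ, Real.exp (-((y : ℝ) - m) ^ 2 / (2 * σ2)) :=
    tsum_nonneg fun y => (Real.exp_pos _).le
  have hd : ∑' y : ℤ, dgaussMass σ2 y = ∑' n : ℤ, Real.exp (-Real.pi * a * (n : ℝ) ^ 2) := by
    congr 1
    ext n
    rw [dgaussMass, hσ]
    congr 1
    field_simp
  rw [hd, Real.tsum_exp_neg_mul_int_sq ha0, ← Real.norm_of_nonneg h0, ← Complex.norm_real, key,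
    norm_mul, norm_mul]
  have e1 : ‖Complex.exp (-Real.pi * a * m ^ 2)‖ = Real.exp (-(Real.pi * a * m ^ 2)) := by
    rw [Complex.norm_exp]
    congr 1
    rw [show (-Real.pi * a * m ^ 2 : ℂ) = ((-(Real.pi * a * m ^ 2) : ℝ) : ℂ) by push_cast; ring]
    exact Complex.ofReal_re _
  have e2 : ‖1 / (a : ℂ) ^ (1 / 2 : ℂ)‖ = 1 / a ^ (1 / 2 : ℝ) := by
    rw [norm_div, norm_one, Complex.norm_cpow_eq_rpow_re_of_pos ha0]
    norm_num
  have e3 : ‖∑' n : ℤ, Complex.exp (-Real.pi / a * (n + Complex.I * (a * m : ℂ)) ^ 2)‖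
      ≤ Real.exp (Real.pi * a * m ^ 2) * ∑' n : ℤ, Real.exp (-Real.pi / a * (n : ℝ) ^ 2) := by
    rw [← tsum_mul_left]
    simp_rw [← hn]
    apply norm_tsum_le_tsum_norm
    simp_rw [hn]
    exact hs.mul_left _
  rw [e1, e2]
  have hpos : (0:ℝ) ≤ 1 / a ^ (1 / 2 : ℝ) := by positivity
  calc _ ≤ Real.exp (-(Real.pi * a * m ^ 2)) * (1 / a ^ (1 / 2 : ℝ) * (Real.exp (Real.pi * a * m ^ 2) * ∑' n : ℤ, Real.exp (-Real.pi / a * (n : ℝ) ^ 2))) := by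
        gcongr
    _ = (Real.exp (-(Real.pi * a * m ^ 2)) * Real.exp (Real.pi * a * m ^ 2)) * (1 / a ^ (1 / 2 : ℝ) * ∑' n : ℤ, Real.exp (-Real.pi / a * (n : ℝ) ^ 2)) := by ring
    _ = _ := by rw [← Real.exp_add]; simp

/-- Exponential moment form of the Renyi divergence. -/
noncomputable def rmom {β : Type*} (α : ℝ) (P Q : PMF β) : ℝ≥0∞ :=
  ∑' b : β, P b ^ α * Q b ^ (1 - α)

/-- Divergence bound. -/
def Dbd {β : Type*} (α : ℝ) (P Q : PMF β) (c : ℝ) : Prop :=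
  rmom α P Q ≤ ENNReal.ofReal (Real.exp (α * (α - 1) * c))

lemma Dbd.renyi {β : Type*} {α : ℝ} (hα : 1 < α) {P Q : PMF β} {c : ℝ} (hc : 0 ≤ c)
    (h : Dbd α P Q c) : renyiDiv α P Q ≤ α * c := by
  unfold renyiDiv
  have hne : rmom α P Q ≠ ⊤ := ne_top_of_le_ne_top ENNReal.ofReal_ne_top h
  have e : ∑' b : β, (P b).toReal ^ α * (Q b).toReal ^ (1 - α) = (rmom α P Q).toReal := by
    rw [rmom, ENNReal.tsum_toReal_eq (fun b => ENNReal.ne_top_of_tsum_ne_top hne b)]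
    congr 1
    ext b
    rw [ENNReal.toReal_mul, ENNReal.toReal_rpow, ENNReal.toReal_rpow]
  have h1 : (rmom α P Q).toReal ≤ Real.exp (α * (α - 1) * c) :=
    ENNReal.toReal_le_of_le_ofReal (Real.exp_pos _).le h
  have hα1 : 0 < α - 1 := by linarith
  have h2 : Real.log (rmom α P Q).toReal ≤ α * (α - 1) * c := by
    rcases (ENNReal.toReal_nonneg (a := rmom α P Q)).eq_or_lt with h0 | h0
    · rw [← h0, Real.log_zero]
      have : 0 < α := by linarith
      positivity
    · rw [← Real.log_exp (α * (α - 1) * c)]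
      exact Real.log_le_log h0 h1
  rw [e]
  calc _ ≤ (α - 1)⁻¹ * (α * (α - 1) * c) := by gcongr
    _ = α * c := by field_simp

lemma Dbd.mono {β : Type*} {α : ℝ} (hα : 1 < α) {P Q : PMF β} {c d : ℝ} (hcd : c ≤ d)
    (h : Dbd α P Q c) : Dbd α P Q d := by
  refine le_trans h (ENNReal.ofReal_le_ofReal (Real.exp_le_exp.mpr ?_))
  have : 0 < α * (α - 1) := mul_pos (by linarith) (by linarith)
  gcongr

lemma Dbd.refl {β : Type*} {α : ℝ} (hα : 1 < α) (P : PMF β) : Dbd α P P 0 := by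
  have : rmom α P P = 1 := by
    rw [rmom, ← P.tsum_coe]
    congr 1
    ext b
    by_cases h : P b = 0
    · rw [h, ENNReal.zero_rpow_of_pos (by linarith), zero_mul]
    · rw [← ENNReal.rpow_add _ _ h (P.apply_ne_top b)]
      simp
  simp [Dbd, this]

lemma map_apply_inj {β δ : Type*} {f : β → δ} (hf : Function.Injective f) (P : PMF β) (b : β) :
    (P.map f) (f b) = P b := by
  classical
  rw [PMF.map_apply, tsum_eq_single b]
  · simp
  · intro b' hb'
    rw [if_neg]
    exact fun h => hb' (hf h).symm

lemma map_apply_not_range {β δ : Type*} {f : β → δ} (P : PMF β) (d : δ) (h : d ∉ Set.range f) :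
    (P.map f) d = 0 := by
  classical
  rw [PMF.map_apply, ENNReal.tsum_eq_zero]
  intro a
  rw [if_neg]
  rintro rfl
  exact h ⟨a, rfl⟩

lemma rmom_map {β δ : Type*} {α : ℝ} (hα : 1 < α) {f : β → δ} (hf : Function.Injective f)
    (P Q : PMF β) : rmom α (P.map f) (Q.map f) = rmom α P Q := by
  unfold rmom
  rw [← hf.tsum_eq]
  · simp_rw [map_apply_inj hf]
  · intro d hd
    by_contra hr
    apply hd
    simp only
    rw [map_apply_not_range P d hr, ENNReal.zero_rpow_of_pos (by linarith), zero_mul]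

lemma Dbd.map {β δ : Type*} {α : ℝ} (hα : 1 < α) {f : β → δ} (hf : Function.Injective f)
    {P Q : PMF β} {c : ℝ} (h : Dbd α P Q c) : Dbd α (P.map f) (Q.map f) c := by
  rwa [Dbd, rmom_map hα hf]

/-- Joint distribution on a sigma type. -/
noncomputable def jointS {A : Type*} {B : A → Type*} (P : PMF A) (K : (a : A) → PMF (B a)) :
    PMF (Σ a, B a) :=
  P.bind fun a => (K a).map (Sigma.mk a)

lemma jointS_apply {A : Type*} {B : A → Type*} (P : PMF A) (K : (a : A) → PMF (B a))
    (a : A) (b : B a) : jointS P K ⟨a, b⟩ = P a * K a b := by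
  rw [jointS, PMF.bind_apply, tsum_eq_single a]
  · rw [map_apply_inj sigma_mk_injective]
  · intro a' ha'
    rw [map_apply_not_range, mul_zero]
    rintro ⟨b', hb'⟩
    exact ha' (congrArg Sigma.fst hb')

lemma Dbd.joint {A : Type*} {B : A → Type*} {α : ℝ} {P Q : PMF A}
    {K L : (a : A) → PMF (B a)} {c d : ℝ} (h : Dbd α P Q c) (h' : ∀ a, Dbd α (K a) (L a) d) :
    Dbd α (jointS P K) (jointS Q L) (c + d) := by
  unfold Dbd
  rw [mul_add, Real.exp_add, ENNReal.ofReal_mul (Real.exp_pos _).le]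
  have : rmom α (jointS P K) (jointS Q L) = ∑' a, (P a ^ α * Q a ^ (1 - α)) * rmom α (K a) (L a) := by
    rw [rmom, ENNReal.tsum_sigma']
    congr 1
    ext a
    rw [rmom, ← ENNReal.tsum_mul_left]
    congr 1
    ext b
    rw [jointS_apply, jointS_apply,
      ENNReal.mul_rpow_of_ne_top (P.apply_ne_top _) ((K a).apply_ne_top _),
      ENNReal.mul_rpow_of_ne_top (Q.apply_ne_top _) ((L a).apply_ne_top _)]
    exact mul_mul_mul_comm _ _ _ _
  rw [this]
  calc _ ≤ ∑' a, (P a ^ α * Q a ^ (1 - α)) * ENNReal.ofReal (Real.exp (α * (α - 1) * d)) :=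
        ENNReal.tsum_le_tsum fun a => mul_le_mul_right (h' a) _
    _ = rmom α P Q * ENNReal.ofReal (Real.exp (α * (α - 1) * d)) := by
        rw [ENNReal.tsum_mul_right, rmom]
    _ ≤ _ := mul_le_mul_left h _

lemma pmfPiFin_succ (n : ℕ) (β : Fin (n + 1) → Type u) (p : (i : Fin (n + 1)) → PMF (β i)) :
    pmfPiFin (n + 1) β p =
      (jointS (p 0) (fun _ => pmfPiFin n (fun i => β i.succ) (fun i => p i.succ))).map
        (fun z => (Fin.cons z.1 z.2 : (i : Fin (n + 1)) → β i)) := by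
  rw [jointS, PMF.map_bind]
  simp_rw [PMF.map_comp]
  rfl

lemma cons_inj (n : ℕ) (β : Fin (n + 1) → Type u) : Function.Injective
    (fun z : Σ _ : β 0, ((i : Fin n) → β i.succ) =>
      (Fin.cons z.1 z.2 : (i : Fin (n + 1)) → β i)) := by
  rintro ⟨a, f⟩ ⟨b, g⟩ h
  obtain ⟨h1, h2⟩ := Fin.cons_injective2 h
  subst h1 h2
  rfl

lemma Dbd.piFin {α : ℝ} (hα : 1 < α) (n : ℕ) (β : Fin n → Type u) (p q : (i : Fin n) → PMF (β i))
    (c : Fin n → ℝ) (h : ∀ i, Dbd α (p i) (q i) (c i)) :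
    Dbd α (pmfPiFin n β p) (pmfPiFin n β q) (∑ i, c i) := by
  induction n with
  | zero =>
    simp only [Finset.univ_eq_empty, Finset.sum_empty]
    exact Dbd.refl hα _
  | succ n ih =>
    rw [pmfPiFin_succ, pmfPiFin_succ, Fin.sum_univ_succ]
    exact Dbd.map hα (cons_inj n β) (Dbd.joint (h 0) fun _ => ih _ _ _ _ fun i => h i.succ)

lemma pmfPiFin_apply (n : ℕ) (β : Fin n → Type u) (p : (i : Fin n) → PMF (β i))
    (f : (i : Fin n) → β i) : pmfPiFin n β p f = ∏ i, p i (f i) := by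
  induction n with
  | zero =>
    have : f = (fun i => i.elim0) := by ext i; exact i.elim0
    rw [this]
    simp [pmfPiFin]
  | succ n ih =>
    rw [pmfPiFin_succ, Fin.prod_univ_succ]
    have : f = (fun z : Σ _ : β 0, ((i : Fin n) → β i.succ) =>
      (Fin.cons z.1 z.2 : (i : Fin (n + 1)) → β i)) ⟨f 0, fun i => f i.succ⟩ :=
      (Fin.cons_self_tail f).symm
    conv_lhs => rw [this]
    rw [map_apply_inj (cons_inj n β), jointS_apply, ih]

lemma Dbd.pi {α : ℝ} (hα : 1 < α) {ι : Type*} [Fintype ι] {β : ι → Type*}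
    (p q : (i : ι) → PMF (β i))
    (c : ι → ℝ) (h : ∀ i, Dbd α (p i) (q i) (c i)) :
    Dbd α (pmfPi p) (pmfPi q) (∑ i, c i) := by
  unfold pmfPi
  rw [← Equiv.sum_comp (Fintype.equivFin ι).symm]
  exact Dbd.map hα (Equiv.injective _) (Dbd.piFin hα _ _ _ _ _ fun k => h _)

lemma pmfPi_apply {ι : Type*} [Fintype ι] {β : ι → Type*}
    (p : (i : ι) → PMF (β i)) (f : (i : ι) → β i) : pmfPi p f = ∏ i, p i (f i) := by
  unfold pmfPi
  have : f = (Equiv.piCongrLeft' β (Fintype.equivFin ι)).symm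
    ((Equiv.piCongrLeft' β (Fintype.equivFin ι)) f) := by simp
  conv_lhs => rw [this]
  rw [map_apply_inj (Equiv.injective _), pmfPiFin_apply,
    ← Equiv.prod_comp (Fintype.equivFin ι).symm]
  rfl

lemma pmfPi_map_shift {n : ℕ} (p : PMF ℤ) (k : Fin n → ℤ) :
    (pmfPi fun _ : Fin n => p).map (fun v c => k c + v c) =
      pmfPi fun c => p.map (fun z => k c + z) := by
  ext w
  have hi : Function.Injective (fun (v : Fin n → ℤ) c => k c + v c) := by
    intro v v' h
    ext c
    simpa using congrFun h c
  have : w = (fun (v : Fin n → ℤ) c => k c + v c) (fun c => w c - k c) := by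
    ext c; simp
  conv_lhs => rw [this]
  rw [map_apply_inj hi, pmfPi_apply, pmfPi_apply]
  refine Finset.prod_congr rfl fun c _ => ?_
  have e : w c = (fun z => k c + z) (w c - k c) := by simp
  conv_rhs => rw [e]
  rw [map_apply_inj (add_right_injective (k c))]

lemma dgauss_shift_apply {σ2 : ℝ} (h : 0 < σ2) (k y : ℤ) :
    ((dgaussPMF σ2).map (fun z => k + z)) y =
      ENNReal.ofReal (dgaussMass σ2 (y - k) / ∑' y : ℤ, dgaussMass σ2 y) := by
  have e : y = (fun z => k + z) (y - k) := by simp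
  conv_lhs => rw [e]
  rw [map_apply_inj (add_right_injective k)]
  have e2 : dgaussPMF σ2 = _ := dif_pos h
  rw [e2]
  rfl

lemma Dbd.gauss {α : ℝ} {σ2 : ℝ} (h : 0 < σ2) (k k' : ℤ) :
    Dbd α ((dgaussPMF σ2).map (fun z => k + z)) ((dgaussPMF σ2).map (fun z => k' + z))
      (((k - k') ^ 2 : ℤ) / (2 * σ2)) := by
  unfold Dbd rmom
  simp_rw [dgauss_shift_apply h]
  have hS := dgaussMass_tsum_pos h
  have hsh := shifted_tsum_le h (α * k + (1 - α) * k')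
  have hsum := shifted_summable h (α * k + (1 - α) * k')
  obtain ⟨S, hSdef⟩ : ∃ S, S = ∑' y : ℤ, dgaussMass σ2 y := ⟨_, rfl⟩
  rw [← hSdef] at hS hsh ⊢
  have e : ∀ y : ℤ, ENNReal.ofReal (dgaussMass σ2 (y - k) / S) ^ α *
      ENNReal.ofReal (dgaussMass σ2 (y - k') / S) ^ (1 - α) =
      ENNReal.ofReal (Real.exp (α * (α - 1) * (((k - k') ^ 2 : ℤ) / (2 * σ2))) / S *
        Real.exp (-((y : ℝ) - (α * k + (1 - α) * k')) ^ 2 / (2 * σ2))) := by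
    intro y
    rw [ENNReal.ofReal_rpow_of_pos (div_pos (dgaussMass_pos _ _) hS),
      ENNReal.ofReal_rpow_of_pos (div_pos (dgaussMass_pos _ _) hS),
      ← ENNReal.ofReal_mul (Real.rpow_nonneg (div_pos (dgaussMass_pos _ _) hS).le _)]
    congr 1
    rw [Real.div_rpow (dgaussMass_pos _ _).le hS.le, Real.div_rpow (dgaussMass_pos _ _).le hS.le,
      div_mul_div_comm, ← Real.rpow_add hS, dgaussMass, dgaussMass, ← Real.exp_mul, ← Real.exp_mul,
      ← Real.exp_add,
      div_mul_eq_mul_div (Real.exp (α * (α - 1) * _)), ← Real.exp_add]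
    simp only [add_sub_cancel, Real.rpow_one]
    congr 2
    push_cast
    field_simp
    ring
  simp_rw [e]
  rw [← ENNReal.ofReal_tsum_of_nonneg (fun y => by positivity) (hsum.mul_left _), tsum_mul_left]
  apply ENNReal.ofReal_le_ofReal
  rw [div_mul_eq_mul_div, div_le_iff₀ hS]
  gcongr

/-- `x` and `x'` differ at most in the record `r`. -/
def Near {I : Type*} (r : I) (x x' : Multiset I) : Prop :=
  ∀ (p : I → Prop) [DecidablePred p],
    (((x.filter p).card : ℤ) - ((x'.filter p).card : ℤ)) ^ 2 ≤ (if p r then 1 else 0)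

lemma neighbor_cases {I : Type*} [DecidableEq I] {x x' : Multiset I} (h : Neighbor x x') :
    ∃ r, x = r ::ₘ x' ∨ x' = r ::ₘ x := by
  unfold Neighbor at h
  rw [Multiset.card_add] at h
  have : ((x - x').card = 1 ∧ (x' - x).card = 0) ∨ ((x - x').card = 0 ∧ (x' - x).card = 1) := by
    omega
  rcases this with ⟨h1, h2⟩ | ⟨h2, h1⟩
  · obtain ⟨r, hr⟩ := Multiset.card_eq_one.mp h1
    refine ⟨r, Or.inl ?_⟩
    have hle : x' ≤ x := tsub_eq_zero_iff_le.mp (Multiset.card_eq_zero.mp h2)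
    rw [← Multiset.singleton_add, ← hr]
    exact (tsub_add_cancel_of_le hle).symm
  · obtain ⟨r, hr⟩ := Multiset.card_eq_one.mp h1
    refine ⟨r, Or.inr ?_⟩
    have hle : x ≤ x' := tsub_eq_zero_iff_le.mp (Multiset.card_eq_zero.mp h2)
    rw [← Multiset.singleton_add, ← hr]
    exact (tsub_add_cancel_of_le hle).symm

lemma neighbor_near {I : Type*} [DecidableEq I] {x x' : Multiset I} (h : Neighbor x x') :
    ∃ r, Near r x x' ∧ ∀ (p : I → Prop) [DecidablePred p], ¬ p r → x.filter p = x'.filter p := by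
  obtain ⟨r, rfl | rfl⟩ := neighbor_cases h
  · refine ⟨r, ?_, ?_⟩
    · intro p _
      by_cases hp : p r <;> simp [hp]
    · intro p _ hp
      simp [hp]
  · refine ⟨r, ?_, ?_⟩
    · intro p _
      by_cases hp : p r <;> simp [hp]
    · intro p _ hp
      simp [hp]

lemma Near.filter {I : Type*} {r : I} {x x' : Multiset I} (h : Near r x x') (q : I → Prop)
    [DecidablePred q] : Near r (x.filter q) (x'.filter q) := by
  intro p _
  rw [Multiset.filter_filter, Multiset.filter_filter]
  refine (h (fun a => p a ∧ q a)).trans ?_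
  by_cases hp : p r <;> by_cases hq : q r <;> simp [hp, hq]

lemma Near.card {I : Type*} {r : I} {x x' : Multiset I} (h : Near r x x') :
    ((x.card : ℤ) - (x'.card : ℤ)) ^ 2 ≤ 1 := by
  simpa using h (fun _ => True)

/-- Threshold selection. -/
def selT (Θ1 Θ2 Θ3 y0 : ℤ) : Fin 4 :=
  if y0 < Θ1 then 0 else if y0 < Θ2 then 1 else if y0 < Θ3 then 2 else 3

lemma twoStage_eq {I : Type*} (n : Fin 4 → ℕ) (part : (t : Fin 4) → I → Fin (n t))
    (Θ1 Θ2 Θ3 : ℤ) (ρ γ : ℝ) (x : Multiset I) :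
    twoStage n part Θ1 Θ2 Θ3 ρ γ x =
      (jointS (B := fun y => Fin (n (selT Θ1 Θ2 Θ3 y)) → ℤ)
        ((dgaussPMF (1 / (2 * γ * ρ))).map (fun z => (x.card : ℤ) + z))
        (fun y => pmfPi fun c => (dgaussPMF (1 / (2 * (1 - γ) * ρ))).map
          (fun z => ((x.filter fun r => part (selT Θ1 Θ2 Θ3 y) r = c).card : ℤ) + z))).map
      (fun w => (w.1, (⟨selT Θ1 Θ2 Θ3 w.1, w.2⟩ : Σ t : Fin 4, (Fin (n t) → ℤ)))) := by
  rw [jointS, PMF.map_bind, PMF.bind_map]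
  unfold twoStage
  congr 1
  ext1 z0
  simp only [Function.comp_apply]
  rw [← pmfPi_map_shift, PMF.map_comp, PMF.map_comp]
  rfl

lemma Dbd.twoStage {I : Type*} {α : ℝ} (hα : 1 < α) (n : Fin 4 → ℕ)
    (part : (t : Fin 4) → I → Fin (n t))
    (Θ1 Θ2 Θ3 : ℤ) {ρ γ : ℝ} (hρ : 0 < ρ) (hγ0 : 0 < γ) (hγ1 : γ < 1) {x x' : Multiset I} {r : I}
    (h : Near r x x') :
    Dbd α (twoStage n part Θ1 Θ2 Θ3 ρ γ x) (twoStage n part Θ1 Θ2 Θ3 ρ γ x') ρ := by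
  have hγ : 0 < 1 - γ := by linarith
  rw [twoStage_eq, twoStage_eq]
  apply Dbd.map hα
  · rintro ⟨a, f⟩ ⟨b, g⟩ hab
    simp only [Prod.mk.injEq] at hab
    obtain ⟨rfl, h2⟩ := hab
    simpa using h2
  rw [show Dbd α _ _ ρ = Dbd α _ _ (γ * ρ + (1 - γ) * ρ) by congr 1; ring]
  apply Dbd.joint
  · refine Dbd.mono hα ?_ (Dbd.gauss (by positivity) _ _)
    have : ((((x.card : ℤ) - (x'.card : ℤ)) ^ 2 : ℤ) : ℝ) ≤ 1 := by exact_mod_cast h.card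
    calc _ ≤ 1 / (2 * (1 / (2 * γ * ρ))) := by gcongr
      _ = _ := by field_simp
  · intro y
    refine Dbd.mono hα ?_ (Dbd.pi hα _ _ _ fun c => Dbd.gauss (by positivity) _ _)
    calc _ ≤ ∑ c, (if part (selT Θ1 Θ2 Θ3 y) r = c then 1 else 0) / (2 * (1 / (2 * (1 - γ) * ρ))) := by
          refine Finset.sum_le_sum fun c _ => ?_
          gcongr
          have := h (fun r => part (selT Θ1 Θ2 Θ3 y) r = c)
          exact_mod_cast this
      _ = _ := by
        rw [← Finset.sum_div]
        simp
        field_simp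

/-- SafeTab-P satisfies (unbounded) `ρ_total`-zCDP, where
`ρ_total = ∑ i, ρ i`, provided each flatmap `g i` has stability at most `s i`. -/
theorem safeTabP_zCDP {I : Type*} [DecidableEq I] {ω : ℕ}
    (P : Fin ω → Type*) [∀ i, Fintype (P i)] [∀ i, DecidableEq (P i)]
    (g : (i : Fin ω) → I → Finset (P i))
    (s : Fin ω → ℕ) (hs : ∀ i, 0 < s i)
    (hstab : ∀ i (r : I), (g i r).card ≤ s i)
    (ρ : Fin ω → ℝ) (hρ : ∀ i, 0 < ρ i)
    (γ : ℝ) (hγ0 : 0 < γ) (hγ1 : γ < 1)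
    (TotalOnly : (i : Fin ω) → P i → Prop) [∀ i, DecidablePred (TotalOnly i)]
    (nCells : (i : Fin ω) → P i → Fin 4 → ℕ)
    (part : (i : Fin ω) → (j : P i) → (t : Fin 4) → I → Fin (nCells i j t))
    (Θ1 Θ2 Θ3 : (i : Fin ω) → P i → ℤ) :
    zCDP (safeTabP P g s ρ γ TotalOnly nCells part Θ1 Θ2 Θ3) (∑ i, ρ i) := by
  intro x x' hn α hα
  obtain ⟨r, hnear, hfil⟩ := neighbor_near hn
  apply Dbd.renyi hα (Finset.sum_nonneg fun i _ => (hρ i).le)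
  unfold safeTabP
  apply Dbd.pi hα
  intro i
  have hsi : (0 : ℝ) < s i := by exact_mod_cast hs i
  have hρi := hρ i
  have hle : ∑ j : P i, (if j ∈ g i r then ρ i / s i else 0) ≤ ρ i := by
    rw [Finset.sum_ite_mem, Finset.univ_inter, Finset.sum_const, nsmul_eq_mul]
    have : ((g i r).card : ℝ) ≤ s i := by exact_mod_cast hstab i r
    calc _ ≤ (s i : ℝ) * (ρ i / s i) := by gcongr
      _ = ρ i := by field_simp
  refine Dbd.mono hα hle ?_
  apply Dbd.pi hα
  intro j
  by_cases hj : j ∈ g i r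
  · rw [if_pos hj]
    have hnf := hnear.filter (fun r => j ∈ g i r)
    by_cases hT : TotalOnly i j
    · simp only [if_pos hT]
      have e : ∀ k : ℤ, (dgaussPMF ((s i : ℝ) / (2 * ρ i))).map
          (fun zn => (Sum.inl (k + zn) : ℤ ⊕ (ℤ × Σ t : Fin 4, (Fin (nCells i j t) → ℤ)))) =
          ((dgaussPMF ((s i : ℝ) / (2 * ρ i))).map (fun zn => k + zn)).map Sum.inl := by
        intro k
        rw [PMF.map_comp]
        rfl
      rw [e, e]
      apply Dbd.map hα Sum.inl_injective
      refine Dbd.mono hα ?_ (Dbd.gauss (by positivity) _ _)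
      have h1 := hnf.card
      calc _ ≤ 1 / (2 * ((s i : ℝ) / (2 * ρ i))) := by
            gcongr
            exact_mod_cast h1
        _ = _ := by field_simp
    · simp only [if_neg hT]
      apply Dbd.map hα Sum.inr_injective
      exact Dbd.twoStage hα _ _ _ _ _ (by positivity) hγ0 hγ1 hnf
  · rw [if_neg hj, hfil (fun r => j ∈ g i r) hj]
    exact Dbd.refl hα _
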